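/- Cut optimality condition: Let G be a finite connected graph with vector edge costs v^e ∈ R^p and let OWA have non-increasing nonnegative weights. Let C be a cut of G and e ∈ C an edge such that OWA(v^e − v^{e'}) ≤ 0 for all edges e' ∈ C. Then there exists a spanning tree T containing e with OWA(Σ_{a∈T} v^a) minimal over all spanning trees of G. -/

import Mathlib

noncomputable def sortedDesc {p : ℕ} (y : Fin p → ℝ) : Fin p → ℝ :=
  fun i => y (Tuple.sort y (Fin.rev i))

/-- Ordered weighted average. -/
noncomputable def owa {p : ℕ} (w y : Fin p → ℝ) : ℝ :=
  ∑ i, w i * sortedDesc y i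


/-- The vector cost of a subgraph: sum of the edge cost vectors over its edges. -/
noncomputable def cost {V : Type*} [Fintype V] {p : ℕ} (v : Sym2 V → Fin p → ℝ)
    (T : SimpleGraph V) : Fin p → ℝ :=
  ∑ e ∈ T.edgeSet.toFinite.toFinset, v e

theorem sum_mul_comp_perm_le_owa {p : ℕ} {w : Fin p → ℝ} (hw : Antitone w) (y : Fin p → ℝ)
    (σ : Equiv.Perm (Fin p)) : ∑ i, w i * y (σ i) ≤ owa w y := by
  have hy : Antitone (sortedDesc y) := fun i j hij =>
    Tuple.monotone_sort y (Fin.rev_le_rev.mpr hij)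
  have h := (hw.monovary hy).sum_mul_comp_perm_le_sum_mul
    (σ := σ.trans ((Tuple.sort y).symm.trans Fin.revPerm))
  simpa [owa, sortedDesc] using h

theorem owa_add_le {p : ℕ} {w : Fin p → ℝ} (hw : Antitone w) (y z : Fin p → ℝ) :
    owa w (y + z) ≤ owa w y + owa w z := by
  let σ : Equiv.Perm (Fin p) := Fin.revPerm.trans (Tuple.sort (y + z))
  calc owa w (y + z) = ∑ i, w i * y (σ i) + ∑ i, w i * z (σ i) := by
        simp [owa, sortedDesc, σ, mul_add, Finset.sum_add_distrib]
    _ ≤ owa w y + owa w z :=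
        add_le_add (sum_mul_comp_perm_le_owa hw y σ) (sum_mul_comp_perm_le_owa hw z σ)

open SimpleGraph in
/-- Adding an edge `ab` to a tree and removing an edge of the path from `a` to `b` yields a tree. -/
theorem SimpleGraph.IsTree.deleteEdges_sup_edge {V : Type*} {T : SimpleGraph V} (hT : T.IsTree)
    {a b : V} (hab : ¬ T.Adj a b) (hne : a ≠ b) {P : T.Walk a b} (hP : P.IsPath) {e : Sym2 V}
    (he : e ∈ P.edges) : (T.deleteEdges {e} ⊔ edge a b).IsTree := by
  classical
  induction e with | h x y =>
  have hxy : s(x, y) ≠ s(a, b) := fun h =>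
    hab (T.mem_edgeSet.mp (h ▸ P.edges_subset_edgeSet he))
  constructor
  · have hadj : (T ⊔ edge a b).Adj b a := by simp [edge_adj, hne, hne.symm]
    have hcycle : (Walk.cons hadj (P.mapLe le_sup_left)).IsCycle := by
      rw [Walk.cons_isCycle_iff, Walk.isPath_mapLe, Walk.edges_mapLe_eq_edges]
      exact ⟨hP, fun h => hab (T.mem_edgeSet.mp (P.edges_subset_edgeSet h)).symm⟩
    have hbridge : ¬ (T ⊔ edge a b).IsBridge s(x, y) := fun h =>
      h.notMem_edges_of_isCycle hcycle (by
        rw [Walk.edges_cons, Walk.edges_mapLe_eq_edges]; exact List.mem_cons_of_mem _ he)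
    exact ((hT.connected.mono le_sup_left).connected_delete_edge_of_not_isBridge hbridge).mono
      (by rw [deleteEdges_sup]; exact sup_le_sup_left (deleteEdges_le _) _)
  · refine (hT.isAcyclic.anti (deleteEdges_le _)).sup_edge_of_not_reachable fun h => ?_
    obtain ⟨q, hq⟩ := reachable_deleteEdges_iff_exists_walk.mp h
    have hPq : (⟨P, hP⟩ : T.Path a b) = q.toPath :=
      (isAcyclic_iff_subsingleton_path.mp hT.isAcyclic a b).elim _ _
    exact hq (Walk.edges_toPath_subset_edges q (hPq ▸ he))

open SimpleGraph in
theorem cost_deleteEdges_sup_edge {V : Type*} [Fintype V] {p : ℕ} (v : Sym2 V → Fin p → ℝ)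
    {T : SimpleGraph V} {a b : V} (hab : ¬ T.Adj a b) (hne : a ≠ b) {e : Sym2 V}
    (he : e ∈ T.edgeSet) :
    cost v (T.deleteEdges {e} ⊔ edge a b) = cost v T + (v s(a, b) - v e) := by
  classical
  have hset : (T.deleteEdges {e} ⊔ edge a b).edgeSet.toFinite.toFinset =
      insert s(a, b) (T.edgeSet.toFinite.toFinset.erase e) := by
    ext f
    simp only [Set.Finite.mem_toFinset, edgeSet_sup, edgeSet_deleteEdges, edgeSet_edge,
      Finset.mem_insert, Finset.mem_erase, Set.mem_union, Set.mem_sdiff, Set.mem_singleton_iff]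
    grind [Sym2.mem_diagSet, Sym2.mk_isDiag_iff]
  rw [cost, hset, Finset.sum_insert (by simp [hab]), cost,
    ← Finset.add_sum_erase (T.edgeSet.toFinite.toFinset) v (by simpa using he)]
  abel

theorem cut_optimality_condition {V : Type*} [Fintype V] {p : ℕ}
    (G : SimpleGraph V) (hG : G.Connected)
    (v : Sym2 V → Fin p → ℝ) (w : Fin p → ℝ) (hw : Antitone w) (hw0 : ∀ i, 0 ≤ w i)
    (S : Set V) (hS : S.Nonempty) (hSc : Sᶜ.Nonempty)
    (e0 : Sym2 V)
    (he0 : e0 ∈ G.edgeSet ∧ ∃ a b, a ∈ S ∧ b ∉ S ∧ e0 = s(a, b))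
    (hbest : ∀ e' : Sym2 V,
      (e' ∈ G.edgeSet ∧ ∃ a b, a ∈ S ∧ b ∉ S ∧ e' = s(a, b)) →
      owa w (v e0 - v e') ≤ 0) :
    ∃ T : SimpleGraph V, T ≤ G ∧ T.IsTree ∧ e0 ∈ T.edgeSet ∧
      ∀ T' : SimpleGraph V, T' ≤ G → T'.IsTree →
        owa w (cost v T) ≤ owa w (cost v T') := by
  obtain ⟨T₀, ⟨hT₀G, hT₀⟩, hmin⟩ := Set.exists_min_image {T | T ≤ G ∧ T.IsTree}
    (fun T => owa w (cost v T)) (Set.toFinite _) hG.exists_isTree_le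
  by_cases hmem : e0 ∈ T₀.edgeSet
  · exact ⟨T₀, hT₀G, hT₀, hmem, fun T' h h' => hmin T' ⟨h, h'⟩⟩
  obtain ⟨he0G, a, b, ha, hb, rfl⟩ := he0
  have hne : a ≠ b := fun h => hb (h ▸ ha)
  obtain ⟨P, hP⟩ := hT₀.connected.exists_isPath a b
  obtain ⟨d, hd, hdS, hdS'⟩ := P.exists_boundary_dart S ha hb
  have hdP : d.edge ∈ P.edges := List.mem_map_of_mem hd
  refine ⟨T₀.deleteEdges {d.edge} ⊔ SimpleGraph.edge a b,
    sup_le ((SimpleGraph.deleteEdges_le _).trans hT₀G) ?_,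
    hT₀.deleteEdges_sup_edge hmem hne hP hdP, ?_, fun T' h h' => ?_⟩
  · exact (SimpleGraph.edge_le_iff G).mpr (Or.inr he0G)
  · simp [hne]
  · have hcut := hbest d.edge
      ⟨SimpleGraph.edgeSet_mono hT₀G d.edge_mem, d.fst, d.snd, hdS, hdS', rfl⟩
    rw [cost_deleteEdges_sup_edge v hmem hne d.edge_mem]
    linarith [owa_add_le hw (cost v T₀) (v s(a, b) - v d.edge), hmin T' ⟨h, h'⟩]
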